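/- (Standard structure on the E₈-singularity: the icosahedron.) For every z in the upper half-plane ℍ, with x₁(z) = η(z)·a(z) and x₂(z) = η(z)·b(z) built from the theta constants of order 5: f(x₁(z), x₂(z)) = −Δ(z), H(x₁(z), x₂(z)) = −η(z)⁸·Δ(z)·E₄(z), T(x₁(z), x₂(z)) = Δ(z)²·E₆(z); consequently T(x₁(z),x₂(z))² + H(x₁(z),x₂(z))³ = 1728·f(x₁(z),x₂(z))⁵. -/

import Mathlib

noncomputable section

open Complex

def kleinF (z1 z2 : ℂ) : ℂ := z1 * z2 * (z1 ^ 10 + 11 * z1 ^ 5 * z2 ^ 5 - z2 ^ 10)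
def kleinH (z1 z2 : ℂ) : ℂ :=
  -(z1 ^ 20 + z2 ^ 20) + 228 * (z1 ^ 15 * z2 ^ 5 - z1 ^ 5 * z2 ^ 15) - 494 * z1 ^ 10 * z2 ^ 10
def kleinT (z1 z2 : ℂ) : ℂ :=
  (z1 ^ 30 + z2 ^ 30) + 522 * (z1 ^ 25 * z2 ^ 5 - z1 ^ 5 * z2 ^ 25)
    - 10005 * (z1 ^ 20 * z2 ^ 10 + z1 ^ 10 * z2 ^ 20)

def th5 (c : ℚ) (k : ℤ) (z : ℂ) : ℂ :=
  Complex.exp (2 * Real.pi * Complex.I * (c : ℂ) * z) *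
    ∑' n : ℤ, (-1 : ℂ) ^ n *
      Complex.exp (2 * Real.pi * Complex.I * (((5 * n ^ 2 + k * n : ℤ) : ℂ) / 2) * z)

def aTh (z : ℂ) : ℂ := th5 (9 / 40) 3 z
def bTh (z : ℂ) : ℂ := th5 (1 / 40) 1 z

def etaF (z : ℂ) : ℂ :=
  Complex.exp (2 * Real.pi * Complex.I * z / 24) *
    ∏' n : ℕ, (1 - Complex.exp (2 * Real.pi * Complex.I * z) ^ (n + 1))

def Δfun (z : ℂ) : ℂ := (etaF z) ^ 24

def Eis (k : ℕ) (z : ℂ) : ℂ :=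
  (1 / 2 : ℂ) * ∑' p : {p : ℤ × ℤ // Int.gcd p.1 p.2 = 1},
    1 / ((p.val.1 : ℂ) * z + (p.val.2 : ℂ)) ^ k

def x1 (z : ℂ) : ℂ := etaF z * aTh z
def x2 (z : ℂ) : ℂ := etaF z * bTh z

section KleinInvariants

/-- The element `a + p b`, used to compute in the basis `1, p`. -/
def goldenPair (p a b : ℂ) : ℂ := a + p * b

/-- The quintic powers of the two linear forms `y - φ x` and `x + φ y`, reduced modulo
`φ² = φ + 1`. -/
lemma golden_quintic {p : ℂ} (h : p ^ 2 = p + 1) (x y : ℂ) :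
    (y - p * x) ^ 5 = goldenPair p
      (y ^ 5 + 10 * y ^ 3 * x ^ 2 - 10 * y ^ 2 * x ^ 3 + 10 * y * x ^ 4 - 3 * x ^ 5)
      (-5 * y ^ 4 * x + 10 * y ^ 3 * x ^ 2 - 20 * y ^ 2 * x ^ 3 + 15 * y * x ^ 4
        - 5 * x ^ 5) := by
  unfold goldenPair
  have h3 : p ^ 3 = 2 * p + 1 := by linear_combination (p + 1) * h
  have h4 : p ^ 4 = 3 * p + 2 := by linear_combination (p ^ 2 + p + 2) * h
  have h5 : p ^ 5 = 5 * p + 3 := by linear_combination (p ^ 3 + p ^ 2 + 2 * p + 3) * h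
  linear_combination 10 * y ^ 3 * x ^ 2 * h - 10 * y ^ 2 * x ^ 3 * h3 + 5 * y * x ^ 4 * h4
    - x ^ 5 * h5

lemma golden_pow_six {p : ℂ} (h : p ^ 2 = p + 1) : (2 + p) ^ 6 = 125 * (8 * p + 5) := by
  have h1 : (2 + p) ^ 2 = 5 * (p + 1) := by linear_combination h
  calc (2 + p) ^ 6 = ((2 + p) ^ 2) ^ 3 := by ring
    _ = _ := by rw [h1]; linear_combination (125 * p + 500) * h

lemma golden_pow_ten {p : ℂ} (h : p ^ 2 = p + 1) : (2 + p) ^ 10 = 3125 * (55 * p + 34) := by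
  have h1 : (2 + p) ^ 4 = 25 * (3 * p + 2) := by
    linear_combination (p ^ 2 + 9 * p + 34) * h
  calc (2 + p) ^ 10 = (2 + p) ^ 4 * (2 + p) ^ 6 := by ring
    _ = _ := by rw [h1, golden_pow_six h]; linear_combination 75000 * h

lemma golden_pow_fifteen {p : ℂ} (h : p ^ 2 = p + 1) :
    (2 + p) ^ 15 = 78125 * (1364 * p + 843) := by
  have h1 : (2 + p) ^ 5 = 25 * (11 * p + 7) := by
    linear_combination (p ^ 3 + 11 * p ^ 2 + 52 * p + 143) * h
  calc (2 + p) ^ 15 = (2 + p) ^ 5 * (2 + p) ^ 10 := by ring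
    _ = _ := by rw [h1, golden_pow_ten h]; linear_combination 47265625 * h

lemma golden_quintic' {p : ℂ} (h : p ^ 2 = p + 1) (x y : ℂ) :
    (x + p * y) ^ 5 = goldenPair p
      (x ^ 5 + 10 * x ^ 3 * y ^ 2 + 10 * x ^ 2 * y ^ 3 + 10 * x * y ^ 4 + 3 * y ^ 5)
      (5 * x ^ 4 * y + 10 * x ^ 3 * y ^ 2 + 20 * x ^ 2 * y ^ 3 + 15 * x * y ^ 4
        + 5 * y ^ 5) := by
  have := golden_quintic h (-y) x
  unfold goldenPair at this ⊢
  linear_combination this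

/-- The Klein polynomials factor through `z₁ z₂`, `z₁⁵`, `z₂⁵`. -/
lemma kleinF_eq (x y : ℂ) :
    kleinF x y = x * y * (x ^ 5 * x ^ 5 - y ^ 5 * y ^ 5 + 11 * (x ^ 5 * y ^ 5)) := by
  unfold kleinF; ring

lemma kleinH_eq (x y : ℂ) :
    kleinH x y = -((x ^ 5 * x ^ 5 - y ^ 5 * y ^ 5) * (x ^ 5 * x ^ 5 - y ^ 5 * y ^ 5))
      + 228 * ((x ^ 5 * y ^ 5) * (x ^ 5 * x ^ 5 - y ^ 5 * y ^ 5))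
      - 496 * ((x ^ 5 * y ^ 5) * (x ^ 5 * y ^ 5)) := by
  unfold kleinH; ring

lemma kleinT_eq (x y : ℂ) :
    kleinT x y = (x ^ 5 * x ^ 5 + y ^ 5 * y ^ 5) *
      ((x ^ 5 * x ^ 5 - y ^ 5 * y ^ 5) * (x ^ 5 * x ^ 5 - y ^ 5 * y ^ 5)
      + 522 * ((x ^ 5 * y ^ 5) * (x ^ 5 * x ^ 5 - y ^ 5 * y ^ 5))
      - 10004 * ((x ^ 5 * y ^ 5) * (x ^ 5 * y ^ 5))) := by
  unfold kleinT; ring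

lemma goldenPair_mul {p : ℂ} (h : p ^ 2 = p + 1) (a b c d : ℂ) :
    goldenPair p a b * goldenPair p c d =
      goldenPair p (a * c + b * d) (a * d + b * c + b * d) := by
  unfold goldenPair
  linear_combination b * d * h

lemma goldenPair_add (p a b c d : ℂ) :
    goldenPair p a b + goldenPair p c d = goldenPair p (a + c) (b + d) := by
  unfold goldenPair; ring

lemma goldenPair_sub (p a b c d : ℂ) :
    goldenPair p a b - goldenPair p c d = goldenPair p (a - c) (b - d) := by
  unfold goldenPair; ring

lemma goldenPair_neg (p a b : ℂ) : -goldenPair p a b = goldenPair p (-a) (-b) := by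
  unfold goldenPair; ring

lemma const_mul_goldenPair (p r a b : ℂ) :
    r * goldenPair p a b = goldenPair p (r * a) (r * b) := by
  unfold goldenPair; ring

lemma kleinF_golden {p : ℂ} (h : p ^ 2 = p + 1) (x y : ℂ) :
    kleinF (y - p * x) (x + p * y) = (2 + p) ^ 6 * kleinF x y := by
  have hs : (y - p * x) * (x + p * y) = goldenPair p 0 (y ^ 2 - x * y - x ^ 2) := by
    unfold goldenPair
    linear_combination -x * y * h
  have hr : 125 * (8 * p + 5) * kleinF x y =
      goldenPair p (625 * kleinF x y) (1000 * kleinF x y) := by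
    unfold goldenPair; ring
  rw [kleinF_eq, hs, golden_pow_six h, golden_quintic h, golden_quintic' h, hr]
  simp only [goldenPair_mul h, goldenPair_add, goldenPair_sub, const_mul_goldenPair]
  unfold kleinF
  congr 1 <;> ring

lemma kleinH_golden {p : ℂ} (h : p ^ 2 = p + 1) (x y : ℂ) :
    kleinH (y - p * x) (x + p * y) = (2 + p) ^ 10 * kleinH x y := by
  have hr : 3125 * (55 * p + 34) * kleinH x y =
      goldenPair p (106250 * kleinH x y) (171875 * kleinH x y) := by
    unfold goldenPair; ring
  rw [kleinH_eq, golden_pow_ten h, golden_quintic h, golden_quintic' h, hr]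
  simp only [goldenPair_mul h, goldenPair_add, goldenPair_sub, goldenPair_neg,
    const_mul_goldenPair]
  unfold kleinH
  congr 1 <;> ring

lemma kleinT_golden {p : ℂ} (h : p ^ 2 = p + 1) (x y : ℂ) :
    kleinT (y - p * x) (x + p * y) = -((2 + p) ^ 15 * kleinT x y) := by
  have hr : -(78125 * (1364 * p + 843) * kleinT x y) =
      goldenPair p (-65859375 * kleinT x y) (-106562500 * kleinT x y) := by
    unfold goldenPair; ring
  rw [kleinT_eq, golden_pow_fifteen h, golden_quintic h, golden_quintic' h, hr]
  simp only [goldenPair_mul h, goldenPair_add, goldenPair_sub, const_mul_goldenPair]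
  unfold kleinT
  congr 1 <;> ring

/-- Klein's relation between the icosahedral invariants. -/
lemma klein_relation (x y : ℂ) :
    kleinT x y ^ 2 + kleinH x y ^ 3 = 1728 * kleinF x y ^ 5 := by
  unfold kleinT kleinH kleinF; ring

end KleinInvariants

section EtaFunction

open UpperHalfPlane hiding I

open scoped Real

lemma etaF_eq_eta (z : ℂ) : etaF z = ModularForm.eta z := by
  unfold etaF ModularForm.eta
  simp [ModularForm.eta_q_eq_pow, Function.Periodic.qParam]

lemma etaF_ne_zero {z : ℂ} (hz : 0 < z.im) : etaF z ≠ 0 := by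
  rw [etaF_eq_eta]
  exact ModularForm.eta_ne_zero hz

lemma etaF_add_one_pow_six (z : ℂ) : etaF (z + 1) ^ 6 = I * etaF z ^ 6 := by
  have h1 : cexp (2 * π * I * (z + 1)) = cexp (2 * π * I * z) := by
    rw [mul_add, mul_one, exp_add, exp_two_pi_mul_I, mul_one]
  have h2 : cexp (2 * π * I * (z + 1) / 24) ^ 6 = I * cexp (2 * π * I * z / 24) ^ 6 := by
    have h := exp_add (π / 2 * I) ((6 : ℕ) * (2 * π * I * z / 24))
    rw [exp_pi_div_two_mul_I] at h
    rw [← exp_nat_mul, ← exp_nat_mul, ← h]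
    congr 1
    push_cast
    ring
  rw [etaF, etaF, h1, mul_pow, mul_pow, h2, mul_assoc]

lemma sqrt_sq_eq (z : ℂ) : Complex.sqrt z ^ 2 = z := by
  simp [Complex.sqrt]

lemma etaF_neg_inv_sq {z : ℂ} (hz : 0 < z.im) : etaF (-1 / z) ^ 2 = -I * z * etaF z ^ 2 := by
  have h := ModularForm.eta_comp_eq_csqrt_I_inv hz
  simp only [Function.comp_apply, Pi.smul_apply, Pi.mul_apply, smul_eq_mul] at h
  rw [etaF_eq_eta, etaF_eq_eta, h, mul_pow, mul_pow, inv_pow, sqrt_sq_eq, sqrt_sq_eq, inv_I]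
  ring

end EtaFunction

section ThetaConstants

open scoped Real

/-- The theta series `∑ (-1)ⁿ q^((10 n + j)² / 40)`. -/
def thetaTen (j : ℤ) (z : ℂ) : ℂ :=
  ∑' n : ℤ, cexp (π * I * n + π * I * z * (10 * n + j) ^ 2 / 20)

lemma exp_pi_mul_I_mul_int (n : ℤ) : cexp (π * I * n) = (-1) ^ n := by
  rw [mul_comm, exp_int_mul, exp_pi_mul_I]

lemma th5_eq_thetaTen (j : ℤ) (c : ℚ) (hc : c = j ^ 2 / 40) (z : ℂ) :
    th5 c j z = thetaTen j z := by
  rw [th5, thetaTen, ← tsum_mul_left]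
  refine tsum_congr fun n ↦ ?_
  rw [← exp_pi_mul_I_mul_int, ← exp_add, ← exp_add, hc]
  congr 1
  push_cast
  ring

lemma aTh_eq_thetaTen (z : ℂ) : aTh z = thetaTen 3 z :=
  th5_eq_thetaTen 3 _ (by norm_num) z

lemma bTh_eq_thetaTen (z : ℂ) : bTh z = thetaTen 1 z :=
  th5_eq_thetaTen 1 _ (by norm_num) z

lemma thetaTen_eq_jacobiTheta₂ (j : ℤ) (z : ℂ) :
    thetaTen j z = cexp (π * I * z * j ^ 2 / 20) * jacobiTheta₂ (j * z / 2 + 1 / 2) (5 * z) := by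
  rw [thetaTen, jacobiTheta₂, ← tsum_mul_left]
  refine tsum_congr fun n ↦ ?_
  rw [jacobiTheta₂_term, ← exp_add]
  congr 1
  ring

lemma thetaTen_neg (j : ℤ) (z : ℂ) : thetaTen (-j) z = thetaTen j z := by
  rw [thetaTen, ← (Equiv.neg ℤ).tsum_eq]
  refine tsum_congr fun n ↦ ?_
  rw [exp_add, exp_add, Equiv.neg_apply, exp_pi_mul_I_mul_int, exp_pi_mul_I_mul_int]
  congr 1
  · rw [zpow_neg, ← inv_zpow]
    norm_num
  · push_cast
    ring_nf

lemma thetaTen_add_ten (j : ℤ) (z : ℂ) : thetaTen (j + 10) z = -thetaTen j z := by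
  rw [thetaTen, ← (Equiv.subRight (1 : ℤ)).tsum_eq, thetaTen, ← tsum_neg]
  refine tsum_congr fun n ↦ ?_
  rw [exp_add, exp_add, Equiv.subRight_apply, exp_pi_mul_I_mul_int, exp_pi_mul_I_mul_int,
    zpow_sub_one₀ (by norm_num)]
  push_cast
  ring_nf

lemma thetaTen_five (z : ℂ) : thetaTen 5 z = 0 := by
  have h := thetaTen_add_ten (-5) z
  rw [thetaTen_neg, show (-5 + 10 : ℤ) = 5 by norm_num] at h
  exact self_eq_neg.mp h

lemma thetaTen_seven (z : ℂ) : thetaTen 7 z = -thetaTen 3 z := by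
  rw [← thetaTen_neg 3, ← thetaTen_add_ten, show (-3 + 10 : ℤ) = 7 by norm_num]

/-- The expansion of `thetaTen j (-1 / z)` before splitting into residue classes modulo `5`. -/
lemma thetaTen_neg_inv_eq_tsum (j : ℤ) {z : ℂ} (hz : z ≠ 0) :
    thetaTen j (-1 / z) = 1 / (5 * I / z) ^ (1 / 2 : ℂ) *
      ∑' n : ℤ, cexp (π * I * z * (2 * n - 1) ^ 2 / 20 + π * I * j * (2 * n - 1) / 10) := by
  rw [thetaTen_eq_jacobiTheta₂, jacobiTheta₂_functional_equation,
    show -I * (5 * (-1 / z)) = 5 * I / z by ring, mul_assoc (1 / _), mul_left_comm,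
    jacobiTheta₂, ← tsum_mul_left, ← tsum_mul_left]
  congr 1
  refine tsum_congr fun n ↦ ?_
  rw [jacobiTheta₂_term, ← exp_add, ← exp_add]
  congr 1
  field_simp
  ring

lemma summable_thetaTen_neg_inv (j : ℤ) {z : ℂ} (hz : 0 < z.im) :
    Summable fun n : ℤ ↦
      cexp (π * I * z * (2 * n - 1) ^ 2 / 20 + π * I * j * (2 * n - 1) / 10) := by
  have h : 0 < (z / 5).im := by
    rw [show z / 5 = z / (5 : ℝ) by norm_num, div_ofReal_im]
    positivity
  refine (((summable_jacobiTheta₂_term_iff ((j - z) / 10) (z / 5)).mpr h).mul_left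
    (cexp (π * I * z / 20 - π * I * j / 10))).congr fun n ↦ ?_
  rw [jacobiTheta₂_term, ← exp_add]
  congr 1
  ring

lemma tsum_residue_class {j : ℤ} (hj : Odd j) (z : ℂ) (i : ℤ) :
    ∑' m : ℤ, cexp (π * I * z * (2 * ((5 * m + i : ℤ) : ℂ) - 1) ^ 2 / 20
        + π * I * j * (2 * ((5 * m + i : ℤ) : ℂ) - 1) / 10)
      = cexp (π * I * j * (2 * i - 1) / 10) * thetaTen (2 * i - 1) z := by
  rw [thetaTen, ← tsum_mul_left]
  refine tsum_congr fun m ↦ ?_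
  have h : cexp (π * I * m) = cexp (π * I * ((j * m : ℤ) : ℂ)) := by
    rw [exp_pi_mul_I_mul_int, exp_pi_mul_I_mul_int, zpow_mul, hj.neg_one_zpow]
  rw [exp_add (π * I * m), h, ← exp_add, ← exp_add]
  congr 1
  push_cast
  ring

lemma tsum_int_eq_sum_residues {f : ℤ → ℂ} (hf : Summable f) (N : ℕ) [NeZero N] :
    ∑' n, f n = ∑ i : Fin N, ∑' m : ℤ, f (N * m + (i : ℕ)) := by
  rw [← (Int.divModEquiv N).symm.tsum_eq, ← (Equiv.prodComm (Fin N) ℤ).tsum_eq,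
    Summable.tsum_prod, tsum_fintype]
  · refine Finset.sum_congr rfl fun i _ ↦ tsum_congr fun m ↦ ?_
    simp [Int.divModEquiv, mul_comm]
  · exact (Equiv.summable_iff _).mpr ((Equiv.summable_iff _).mpr hf)

lemma thetaTen_neg_inv {j : ℤ} (hj : Odd j) {z : ℂ} (hz : 0 < z.im) :
    thetaTen j (-1 / z) = 1 / (5 * I / z) ^ (1 / 2 : ℂ) *
      (2 * Complex.cos (π * j / 10) * thetaTen 1 z +
        2 * Complex.cos (3 * π * j / 10) * thetaTen 3 z) := by
  have hz0 : z ≠ 0 := by rintro rfl; simp at hz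
  rw [thetaTen_neg_inv_eq_tsum j hz0,
    tsum_int_eq_sum_residues (summable_thetaTen_neg_inv j hz) 5]
  congr 1
  have h (i : ℕ) := tsum_residue_class hj z i
  have h7 : cexp (π * I * j * 7 / 10) = -cexp (-(π * I * j * 3 / 10)) := by
    rw [show (π * I * j * 7 / 10 : ℂ) = π * I * j + -(π * I * j * 3 / 10) by ring, exp_add,
      exp_pi_mul_I_mul_int, hj.neg_one_zpow, neg_one_mul]
  have e0 := h 0
  have e1 := h 1
  have e2 := h 2
  have e3 := h 3
  have e4 := h 4
  norm_num [thetaTen_five, thetaTen_seven, thetaTen_neg] at e0 e1 e2 e3 e4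
  simp only [Fin.sum_univ_five]
  norm_num
  rw [e0, e1, e2, e3, e4, h7, two_cos, two_cos]
  ring_nf

end ThetaConstants

section Transformation

open scoped Real

lemma kleinF_mul_mul (c x y : ℂ) : kleinF (c * x) (c * y) = c ^ 12 * kleinF x y := by
  unfold kleinF; ring

lemma kleinH_mul_mul (c x y : ℂ) : kleinH (c * x) (c * y) = c ^ 20 * kleinH x y := by
  unfold kleinH; ring

lemma kleinT_mul_mul (c x y : ℂ) : kleinT (c * x) (c * y) = c ^ 30 * kleinT x y := by
  unfold kleinT; ring

lemma two_cos_pi_div_ten_quartic :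
    (2 * Complex.cos (π / 10)) ^ 4 - 5 * (2 * Complex.cos (π / 10)) ^ 2 + 5 = 0 := by
  have h0 : Complex.cos (π / 10) ≠ 0 := by
    have h : 0 < Real.cos (π / 10) :=
      Real.cos_pos_of_mem_Ioo ⟨by linarith [Real.pi_pos], by linarith [Real.pi_pos]⟩
    rw [show (π / 10 : ℂ) = ((π / 10 : ℝ) : ℂ) by push_cast; rfl, ← ofReal_cos]
    exact_mod_cast h.ne'
  have h4 : Complex.cos (3 * (π / 10)) = Complex.sin (2 * (π / 10)) := by
    rw [← Complex.cos_pi_div_two_sub]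
    ring_nf
  rw [Complex.cos_three_mul, Complex.sin_two_mul] at h4
  have hs : 2 * Complex.sin (π / 10) = 4 * Complex.cos (π / 10) ^ 2 - 3 := by
    apply mul_right_cancel₀ h0
    linear_combination -h4
  linear_combination 4 * (Complex.sin_sq_add_cos_sq (π / 10 : ℂ)) -
    (2 * Complex.sin (π / 10) + 4 * Complex.cos (π / 10) ^ 2 - 3) * hs

/-- The inversion acts on the theta constants of order five through an icosahedral matrix. -/
lemma exists_aTh_bTh_neg_inv {z : ℂ} (hz : 0 < z.im) :
    ∃ p s : ℂ, p ^ 2 = p + 1 ∧ s ^ 2 * (2 + p) = -I * z ∧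
      aTh (-1 / z) = s * (bTh z - p * aTh z) ∧ bTh (-1 / z) = s * (aTh z + p * bTh z) := by
  have hz0 : z ≠ 0 := by rintro rfl; simp at hz
  set t : ℂ := 1 / (5 * I / z) ^ (1 / 2 : ℂ) with ht
  have ht2 : t ^ 2 = -I * z / 5 := by
    rw [ht, div_pow, one_pow, one_div (2 : ℂ), ← Complex.sqrt.eq_1, sqrt_sq_eq]
    field_simp
    simp
  set D := 2 * Complex.cos (π / 10) with hD
  have hD4 : D ^ 4 - 5 * D ^ 2 + 5 = 0 := two_cos_pi_div_ten_quartic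
  have hC : 2 * Complex.cos (3 * π / 10) = D ^ 3 - 3 * D := by
    rw [show (3 * π / 10 : ℂ) = 3 * (π / 10) by ring, Complex.cos_three_mul, hD]
    ring
  have hC9 : 2 * Complex.cos (9 * π / 10) = -D := by
    rw [show (9 * π / 10 : ℂ) = π - π / 10 by ring, Complex.cos_pi_sub, hD]
    ring
  have ha := thetaTen_neg_inv (j := 3) (by decide) hz
  have hb := thetaTen_neg_inv (j := 1) (by decide) hz
  rw [show (π * (3 : ℤ) / 10 : ℂ) = 3 * π / 10 by push_cast; ring,
    show (3 * π * (3 : ℤ) / 10 : ℂ) = 9 * π / 10 by push_cast; ring, hC, hC9] at ha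
  rw [show (π * (1 : ℤ) / 10 : ℂ) = π / 10 by push_cast; ring,
    show (3 * π * (1 : ℤ) / 10 : ℂ) = 3 * π / 10 by push_cast; ring, hC] at hb
  simp only [aTh_eq_thetaTen, bTh_eq_thetaTen]
  refine ⟨D ^ 2 - 2, t * (D ^ 3 - 3 * D), ?_, ?_, ?_, ?_⟩
  · linear_combination hD4
  · rw [mul_pow, ht2]
    linear_combination (-I * z / 5) * (D ^ 4 - D ^ 2 - 1) * hD4
  · rw [ha]
    linear_combination t * thetaTen 3 z * D * hD4
  · rw [hb]
    linear_combination -t * thetaTen 1 z * D * hD4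

lemma th5_add_one (c : ℚ) (k : ℤ) (hk : Odd k) (z : ℂ) :
    th5 c k (z + 1) = cexp (2 * π * I * c) * th5 c k z := by
  rw [th5, th5, ← mul_assoc, ← exp_add]
  congr 1
  · ring_nf
  refine tsum_congr fun n ↦ ?_
  obtain ⟨m, hm⟩ : Even (5 * n ^ 2 + k * n) := by
    obtain ⟨l, rfl⟩ := hk
    have := Int.even_mul_succ_self n
    rw [show 5 * n ^ 2 + (2 * l + 1) * n = n * (n + 1) + 2 * (2 * n ^ 2 + l * n) by ring]
    exact this.add (even_two_mul _)
  have h1 : (((5 * n ^ 2 + k * n : ℤ) : ℂ) / 2) = m := by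
    rw [hm]
    push_cast
    ring
  rw [h1, show 2 * π * I * m * (z + 1) = 2 * π * I * m * z + m * (2 * π * I) by ring,
    exp_add _ (m * (2 * π * I)), exp_int_mul_two_pi_mul_I, mul_one]

lemma exists_aTh_bTh_add_one (z : ℂ) :
    ∃ s t : ℂ, s ^ 5 = t ^ 5 ∧ (s ^ 5) ^ 2 = I ∧ s * t = I ∧
      aTh (z + 1) = s * aTh z ∧ bTh (z + 1) = t * bTh z := by
  refine ⟨_, _, ?_, ?_, ?_, th5_add_one _ _ (by decide) z, th5_add_one _ _ (by decide) z⟩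
  · rw [← exp_nat_mul, ← exp_nat_mul, exp_eq_exp_iff_exists_int]
    exact ⟨1, by push_cast; ring⟩
  · rw [← exp_nat_mul, ← exp_nat_mul]
    refine Eq.trans ?_ exp_pi_div_two_mul_I
    rw [exp_eq_exp_iff_exists_int]
    exact ⟨2, by push_cast; ring⟩
  · rw [← exp_add]
    refine Eq.trans ?_ exp_pi_div_two_mul_I
    congr 1
    push_cast
    ring

/-- The normalized Klein form of degree twelve, of weight `0`. -/
def normF (z : ℂ) : ℂ := -kleinF (aTh z) (bTh z) / etaF z ^ 12

/-- The normalized Klein form of degree twenty, of weight `4`. -/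
def normH (z : ℂ) : ℂ := -kleinH (aTh z) (bTh z) / etaF z ^ 12

/-- The normalized Klein form of degree thirty, of weight `6`. -/
def normT (z : ℂ) : ℂ := kleinT (aTh z) (bTh z) / etaF z ^ 18

lemma normF_neg_inv {z : ℂ} (hz : 0 < z.im) : normF (-1 / z) = normF z := by
  have hz0 : z ≠ 0 := by rintro rfl; simp at hz
  have he := etaF_ne_zero hz
  obtain ⟨p, s, hp, hs, ha, hb⟩ := exists_aTh_bTh_neg_inv hz
  have h12 : etaF (-1 / z) ^ 12 = (-I * z) ^ 6 * etaF z ^ 12 := by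
    rw [show etaF (-1 / z) ^ 12 = (etaF (-1 / z) ^ 2) ^ 6 by ring, etaF_neg_inv_sq hz]
    ring
  have hc : -I * z ≠ 0 := by simp [hz0]
  rw [normF, normF, ha, hb, kleinF_mul_mul, kleinF_golden hp, h12,
    show s ^ 12 * ((2 + p) ^ 6 * kleinF (aTh z) (bTh z)) =
      (s ^ 2 * (2 + p)) ^ 6 * kleinF (aTh z) (bTh z) by ring, hs]
  field_simp

lemma normH_neg_inv {z : ℂ} (hz : 0 < z.im) : normH (-1 / z) = z ^ 4 * normH z := by
  have hz0 : z ≠ 0 := by rintro rfl; simp at hz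
  have he := etaF_ne_zero hz
  obtain ⟨p, s, hp, hs, ha, hb⟩ := exists_aTh_bTh_neg_inv hz
  have h12 : etaF (-1 / z) ^ 12 = (-I * z) ^ 6 * etaF z ^ 12 := by
    rw [show etaF (-1 / z) ^ 12 = (etaF (-1 / z) ^ 2) ^ 6 by ring, etaF_neg_inv_sq hz]
    ring
  have hc : -I * z ≠ 0 := by simp [hz0]
  have h4 : z ^ 4 = (-I * z) ^ 4 := by rw [mul_pow, neg_pow, I_pow_four]; ring
  rw [normH, normH, ha, hb, kleinH_mul_mul, kleinH_golden hp, h12, h4,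
    show s ^ 20 * ((2 + p) ^ 10 * kleinH (aTh z) (bTh z)) =
      (s ^ 2 * (2 + p)) ^ 10 * kleinH (aTh z) (bTh z) by ring, hs]
  generalize -I * z = c at *
  field_simp

lemma normT_neg_inv {z : ℂ} (hz : 0 < z.im) : normT (-1 / z) = z ^ 6 * normT z := by
  have hz0 : z ≠ 0 := by rintro rfl; simp at hz
  have he := etaF_ne_zero hz
  obtain ⟨p, s, hp, hs, ha, hb⟩ := exists_aTh_bTh_neg_inv hz
  have h18 : etaF (-1 / z) ^ 18 = (-I * z) ^ 9 * etaF z ^ 18 := by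
    rw [show etaF (-1 / z) ^ 18 = (etaF (-1 / z) ^ 2) ^ 9 by ring, etaF_neg_inv_sq hz]
    ring
  have hc : -I * z ≠ 0 := by simp [hz0]
  have h6 : z ^ 6 = -(-I * z) ^ 6 := by
    rw [mul_pow, neg_pow, show I ^ 6 = I ^ 4 * I ^ 2 by ring, I_pow_four, I_sq]; ring
  rw [normT, normT, ha, hb, kleinT_mul_mul, kleinT_golden hp, h18, h6,
    show s ^ 30 * -((2 + p) ^ 15 * kleinT (aTh z) (bTh z)) =
      -(s ^ 2 * (2 + p)) ^ 15 * kleinT (aTh z) (bTh z) by ring, hs]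
  generalize -I * z = c at *
  field_simp

lemma klein_mul_of_pow_five {s t : ℂ} (h5 : s ^ 5 = t ^ 5) (hI : (s ^ 5) ^ 2 = I)
    (hst : s * t = I) (x y : ℂ) :
    kleinF (s * x) (t * y) = -kleinF x y ∧ kleinH (s * x) (t * y) = -kleinH x y ∧
      kleinT (s * x) (t * y) = -I * kleinT x y := by
  have hxy : s * x * (t * y) = I * (x * y) := by linear_combination x * y * hst
  rw [kleinF_eq, kleinF_eq, kleinH_eq, kleinH_eq, kleinT_eq, kleinT_eq, hxy, mul_pow, mul_pow,
    ← h5]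
  generalize s ^ 5 = k at *
  generalize x ^ 5 = u
  generalize y ^ 5 = v
  refine ⟨?_, ?_, ?_⟩
  · linear_combination x * y * (u * u - v * v + 11 * (u * v)) * (I * hI + I_sq)
  · linear_combination (-((u * u - v * v) * (u * u - v * v)) + 228 * ((u * v) * (u * u - v * v))
      - 496 * ((u * v) * (u * v))) * ((k ^ 2 + I) * hI + I_sq)
  · linear_combination (u * u + v * v) * ((u * u - v * v) * (u * u - v * v)
      + 522 * ((u * v) * (u * u - v * v)) - 10004 * ((u * v) * (u * v))) *
      ((k ^ 4 + k ^ 2 * I + I ^ 2) * hI + I * I_sq)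

lemma normF_add_one (z : ℂ) : normF (z + 1) = normF z := by
  obtain ⟨s, t, h5, hI, hst, ha, hb⟩ := exists_aTh_bTh_add_one z
  have h12 : etaF (z + 1) ^ 12 = -etaF z ^ 12 := by
    rw [show etaF (z + 1) ^ 12 = (etaF (z + 1) ^ 6) ^ 2 by ring, etaF_add_one_pow_six]
    linear_combination etaF z ^ 12 * I_sq
  rw [normF, normF, ha, hb, (klein_mul_of_pow_five h5 hI hst _ _).1, h12, div_neg, neg_neg,
    neg_div]

lemma normH_add_one (z : ℂ) : normH (z + 1) = normH z := by
  obtain ⟨s, t, h5, hI, hst, ha, hb⟩ := exists_aTh_bTh_add_one z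
  have h12 : etaF (z + 1) ^ 12 = -etaF z ^ 12 := by
    rw [show etaF (z + 1) ^ 12 = (etaF (z + 1) ^ 6) ^ 2 by ring, etaF_add_one_pow_six]
    linear_combination etaF z ^ 12 * I_sq
  rw [normH, normH, ha, hb, (klein_mul_of_pow_five h5 hI hst _ _).2.1, h12, div_neg, neg_neg,
    neg_div]

lemma normT_add_one (z : ℂ) : normT (z + 1) = normT z := by
  obtain ⟨s, t, h5, hI, hst, ha, hb⟩ := exists_aTh_bTh_add_one z
  have h18 : etaF (z + 1) ^ 18 = -I * etaF z ^ 18 := by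
    rw [show etaF (z + 1) ^ 18 = (etaF (z + 1) ^ 6) ^ 3 by ring, etaF_add_one_pow_six]
    linear_combination I * etaF z ^ 18 * I_sq
  rw [normT, normT, ha, hb, (klein_mul_of_pow_five h5 hI hst _ _).2.2, h18]
  exact mul_div_mul_left _ _ (by simp)

end Transformation

section Limits

open Filter

open UpperHalfPlane hiding I

open scoped Real Topology

lemma norm_exp_two_pi_mul (r : ℝ) (z : ℂ) :
    ‖cexp (2 * π * I * r * z)‖ = Real.exp (-2 * π * r * z.im) := by
  rw [Complex.norm_exp]
  congr 1
  rw [show 2 * π * I * r * z = ((2 * π * r : ℝ) : ℂ) * (I * z) by push_cast; ring, re_ofReal_mul,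
    I_mul_re]
  ring

lemma tendsto_exp_atImInfty {r : ℝ} (hr : 0 < r) :
    Tendsto (fun τ : ℍ ↦ cexp (2 * π * I * r * τ)) atImInfty (𝓝 0) := by
  rw [tendsto_zero_iff_norm_tendsto_zero]
  simp only [norm_exp_two_pi_mul, coe_im]
  refine Real.tendsto_exp_atBot.comp ?_
  exact tendsto_comap.const_mul_atTop_of_neg (by nlinarith [Real.pi_pos])

/-- The power series part of the theta constants. -/
def thetaTail (k : ℤ) (z : ℂ) : ℂ :=
  ∑' n : ℤ, (-1 : ℂ) ^ n * cexp (2 * π * I * (((5 * n ^ 2 + k * n : ℤ) : ℂ) / 2) * z)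

lemma two_mul_sq_le {k : ℤ} (hk : |k| ≤ 3) (n : ℤ) : 2 * n ^ 2 ≤ 5 * n ^ 2 + k * n := by
  have h3 : |n| ≤ n ^ 2 := by
    rw [← sq_abs]
    exact Int.le_self_sq _
  have h4 : |k * n| ≤ 3 * n ^ 2 := by
    rw [abs_mul]
    nlinarith [abs_nonneg n, abs_nonneg k]
  linarith [neg_abs_le (k * n)]

lemma tendsto_thetaTail_atImInfty {k : ℤ} (hk : |k| ≤ 3) :
    Tendsto (fun τ : ℍ ↦ thetaTail k τ) atImInfty (𝓝 1) := by
  have hexp := two_mul_sq_le hk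
  have hcast (n : ℤ) : (((5 * n ^ 2 + k * n : ℤ) : ℂ) / 2) =
      (((5 * n ^ 2 + k * n : ℤ) : ℝ) / 2 : ℝ) := by push_cast; rfl
  have hsum : Summable fun n : ℤ ↦ Real.exp (-π * n ^ 2 * 2) := by
    have h := ((summable_jacobiTheta₂_term_iff 0 (2 * I)).mpr (by simp)).norm
    simpa [norm_jacobiTheta₂_term] using h
  have h1 : ∑' n : ℤ, (if n = 0 then (1 : ℂ) else 0) = 1 := tsum_ite_eq 0 _
  rw [← congrArg 𝓝 h1]
  refine tendsto_tsum_of_dominated_convergence hsum (fun n ↦ ?_) ?_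
  · split_ifs with h
    · simp [h]
    · have hpos : 0 < 5 * n ^ 2 + k * n := by
        have := hexp n
        have : 0 < n ^ 2 := by positivity
        linarith
      simp only [hcast]
      have hr : 0 < ((5 * n ^ 2 + k * n : ℤ) : ℝ) / 2 := half_pos (by exact_mod_cast hpos)
      have hlim := (tendsto_exp_atImInfty hr).const_mul ((-1 : ℂ) ^ n)
      rw [mul_zero] at hlim
      exact hlim
  · have h2 : ∀ᶠ τ : ℍ in atImInfty, 1 ≤ τ.im := tendsto_comap.eventually (eventually_ge_atTop 1)
    filter_upwards [h2] with τ hτ n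
    rw [norm_mul, norm_zpow, norm_neg, norm_one, one_zpow, one_mul, hcast, norm_exp_two_pi_mul,
      coe_im, Real.exp_le_exp]
    have h2 : (2 * n ^ 2 : ℝ) ≤ ((5 * n ^ 2 + k * n : ℤ) : ℝ) := by exact_mod_cast hexp n
    have h3 : (0 : ℝ) ≤ 2 * n ^ 2 := by positivity
    have h4 : (2 * n ^ 2 : ℝ) ≤ ((5 * n ^ 2 + k * n : ℤ) : ℝ) * τ.im := by nlinarith
    nlinarith [Real.pi_pos]

lemma tendsto_eta_product_atImInfty :
    Tendsto (fun τ : ℍ ↦ ∏' n : ℕ, (1 - cexp (2 * π * I * τ) ^ (n + 1))) atImInfty (𝓝 1) := by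
  have htprod : Tendsto (fun q : ℂ ↦ ∏' n : ℕ, (1 - q ^ (n + 1))) (𝓝 0) (𝓝 1) := by
    have := tendsto_tprod_one_add_of_dominated_convergence (𝓕 := 𝓝 0) (g := 0)
      (f := fun (q : ℂ) (n : ℕ) ↦ -q ^ (n + 1)) (bound := fun n ↦ (1 / 2 : ℝ) ^ (n + 1))
    simp only [Pi.zero_apply, norm_neg, norm_pow, add_zero, tprod_one] at this
    simp_rw [sub_eq_add_neg]
    refine this
      (by simpa only [pow_succ'] using (summable_geometric_of_abs_lt_one (by norm_num)).mul_left _)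
      (fun k ↦ by simpa using ((continuous_pow (M := ℂ) (k + 1)).tendsto 0).neg) ?_
    filter_upwards [Metric.ball_mem_nhds (0 : ℂ) (by norm_num : (0 : ℝ) < 1 / 2)] with q hq k
    exact pow_le_pow_left₀ (norm_nonneg _) (mem_ball_zero_iff.mp hq).le _
  refine htprod.comp ?_
  simpa using tendsto_exp_atImInfty one_pos

/-- Common `q`-expansion data of the theta constants and of `η` at the cusp. -/
lemma exists_tendsto_aTh_bTh_etaF : ∃ u v A P : ℍ → ℂ,
    Tendsto u atImInfty (𝓝 0) ∧ Tendsto v atImInfty (𝓝 1) ∧ Tendsto A atImInfty (𝓝 1) ∧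
    Tendsto P atImInfty (𝓝 1) ∧ ∀ τ : ℍ, ∃ e : ℂ, e ≠ 0 ∧ u τ = e ^ 8 * A τ ∧
      aTh τ = e * u τ ∧ bTh τ = e * v τ ∧ etaF τ ^ 12 = e ^ 20 * P τ ^ 12 ∧
      etaF τ ^ 18 = e ^ 30 * P τ ^ 18 := by
  have hA := tendsto_thetaTail_atImInfty (k := 3) (by norm_num)
  have hv := tendsto_thetaTail_atImInfty (k := 1) (by norm_num)
  refine ⟨fun τ ↦ cexp (2 * π * I * (1 / 5 : ℝ) * τ) * thetaTail 3 τ, _, _, _, ?_, hv, hA,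
    tendsto_eta_product_atImInfty, fun τ ↦ ⟨cexp (2 * π * I * τ / 40), exp_ne_zero _, ?_⟩⟩
  · simpa using (tendsto_exp_atImInfty (r := 1 / 5) (by norm_num)).mul hA
  · have ha : aTh τ = cexp (2 * π * I * (9 / 40 : ℚ) * τ) * thetaTail 3 τ := rfl
    have hb : bTh τ = cexp (2 * π * I * (1 / 40 : ℚ) * τ) * thetaTail 1 τ := rfl
    simp only [ha, hb, etaF, mul_pow, ← mul_assoc, ← exp_nat_mul, ← exp_add]
    refine ⟨?_, ?_, ?_, ?_, ?_⟩ <;> congr 2 <;> push_cast <;> ring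

lemma tendsto_normF_atImInfty : Tendsto (fun τ : ℍ ↦ normF τ) atImInfty (𝓝 1) := by
  obtain ⟨u, v, A, P, hu, hv, hA, hP, h⟩ := exists_tendsto_aTh_bTh_etaF
  have h1 : Tendsto (fun τ ↦ -(A τ * v τ * (u τ ^ 10 + 11 * u τ ^ 5 * v τ ^ 5 - v τ ^ 10)) /
      P τ ^ 12) atImInfty (𝓝 (-(1 * 1 * (0 ^ 10 + 11 * 0 ^ 5 * 1 ^ 5 - 1 ^ 10)) / 1 ^ 12)) :=
    ((hA.mul hv).mul (((hu.pow 10).add ((hu.pow 5).const_mul 11 |>.mul (hv.pow 5))).sub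
      (hv.pow 10))).neg.div (hP.pow 12) (by norm_num)
  norm_num at h1
  refine h1.congr fun τ ↦ ?_
  obtain ⟨e, he, hA, ha, hb, h12, -⟩ := h τ
  rw [normF, ha, hb, kleinF_mul_mul, h12, kleinF, show e ^ 12 * (u τ * v τ *
    (u τ ^ 10 + 11 * u τ ^ 5 * v τ ^ 5 - v τ ^ 10)) = e ^ 20 * (A τ * v τ *
    (u τ ^ 10 + 11 * u τ ^ 5 * v τ ^ 5 - v τ ^ 10)) by nth_rw 1 [hA]; ring, ← mul_neg (e ^ 20),
    mul_div_mul_left _ _ (pow_ne_zero 20 he)]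

lemma tendsto_normH_atImInfty : Tendsto (fun τ : ℍ ↦ normH τ) atImInfty (𝓝 1) := by
  obtain ⟨u, v, A, P, hu, hv, hA, hP, h⟩ := exists_tendsto_aTh_bTh_etaF
  have hc : Continuous fun p : ℂ × ℂ ↦ kleinH p.1 p.2 := by unfold kleinH; fun_prop
  have h1 := ((hc.tendsto (0, 1)).comp (hu.prodMk_nhds hv)).neg.div (hP.pow 12) (by norm_num)
  rw [show -kleinH (0, 1).1 (0, 1).2 / 1 ^ 12 = 1 by norm_num [kleinH]] at h1
  refine h1.congr fun τ ↦ ?_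
  obtain ⟨e, he, hA, ha, hb, h12, -⟩ := h τ
  rw [normH, ha, hb, kleinH_mul_mul, h12, ← mul_neg, mul_div_mul_left _ _ (pow_ne_zero 20 he)]
  rfl

lemma tendsto_normT_atImInfty : Tendsto (fun τ : ℍ ↦ normT τ) atImInfty (𝓝 1) := by
  obtain ⟨u, v, A, P, hu, hv, hA, hP, h⟩ := exists_tendsto_aTh_bTh_etaF
  have hc : Continuous fun p : ℂ × ℂ ↦ kleinT p.1 p.2 := by unfold kleinT; fun_prop
  have h1 := ((hc.tendsto (0, 1)).comp (hu.prodMk_nhds hv)).div (hP.pow 18) (by norm_num)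
  rw [show kleinT (0, 1).1 (0, 1).2 / 1 ^ 18 = 1 by norm_num [kleinT]] at h1
  refine h1.congr fun τ ↦ ?_
  obtain ⟨e, he, hA, ha, hb, -, h18⟩ := h τ
  rw [normT, ha, hb, kleinT_mul_mul, h18, mul_div_mul_left _ _ (pow_ne_zero 30 he)]
  rfl

end Limits

section Holomorphy

open UpperHalfPlane hiding I

lemma differentiableAt_thetaTen (j : ℤ) {z : ℂ} (hz : 0 < z.im) :
    DifferentiableAt ℂ (thetaTen j) z := by
  have h5 : 0 < (5 * z).im := by simpa using hz
  have h := (hasFDerivAt_jacobiTheta₂ (j * z / 2 + 1 / 2) h5).differentiableAt.comp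
    (f := fun z : ℂ ↦ (j * z / 2 + 1 / 2, 5 * z)) z (by fun_prop)
  rw [funext (thetaTen_eq_jacobiTheta₂ j)]
  exact DifferentiableAt.mul (by fun_prop) h

lemma differentiableAt_aTh {z : ℂ} (hz : 0 < z.im) : DifferentiableAt ℂ aTh z := by
  rw [funext aTh_eq_thetaTen]
  exact differentiableAt_thetaTen 3 hz

lemma differentiableAt_bTh {z : ℂ} (hz : 0 < z.im) : DifferentiableAt ℂ bTh z := by
  rw [funext bTh_eq_thetaTen]
  exact differentiableAt_thetaTen 1 hz

lemma differentiableAt_etaF {z : ℂ} (hz : 0 < z.im) : DifferentiableAt ℂ etaF z := by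
  rw [funext etaF_eq_eta]
  exact ModularForm.differentiableAt_eta_of_mem_upperHalfPlaneSet hz

lemma differentiableAt_normF {z : ℂ} (hz : 0 < z.im) : DifferentiableAt ℂ normF z := by
  have ha := differentiableAt_aTh hz
  have hb := differentiableAt_bTh hz
  have he := differentiableAt_etaF hz
  unfold normF kleinF
  exact DifferentiableAt.div (by fun_prop) (by fun_prop) (pow_ne_zero _ (etaF_ne_zero hz))

lemma differentiableAt_normH {z : ℂ} (hz : 0 < z.im) : DifferentiableAt ℂ normH z := by
  have ha := differentiableAt_aTh hz
  have hb := differentiableAt_bTh hz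
  have he := differentiableAt_etaF hz
  unfold normH kleinH
  exact DifferentiableAt.div (by fun_prop) (by fun_prop) (pow_ne_zero _ (etaF_ne_zero hz))

lemma differentiableAt_normT {z : ℂ} (hz : 0 < z.im) : DifferentiableAt ℂ normT z := by
  have ha := differentiableAt_aTh hz
  have hb := differentiableAt_bTh hz
  have he := differentiableAt_etaF hz
  unfold normT kleinT
  exact DifferentiableAt.div (by fun_prop) (by fun_prop) (pow_ne_zero _ (etaF_ne_zero hz))

end Holomorphy

section LevelOne

open Filter ModularForm EisensteinSeries MatrixGroups

open UpperHalfPlane hiding I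

open scoped Topology

variable {k : ℤ} {g : ℂ → ℂ}

lemma slash_S_eq (h : ∀ z : ℂ, 0 < z.im → g (-1 / z) = z ^ k * g z) :
    ((fun τ : ℍ ↦ g τ) ∣[k] ModularGroup.S) = fun τ : ℍ ↦ g τ := by
  ext τ
  have h1 : ((ModularGroup.S • τ : ℍ) : ℂ) = -1 / τ := by
    rw [UpperHalfPlane.modular_S_smul]
    simp [neg_div]
  rw [SL_slash_apply, h1, ModularGroup.denom_S, h τ τ.im_pos, mul_right_comm,
    ← zpow_add₀ (ne_zero τ)]
  simp

lemma slash_T_eq (h : ∀ z : ℂ, g (z + 1) = g z) :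
    ((fun τ : ℍ ↦ g τ) ∣[k] ModularGroup.T) = fun τ : ℍ ↦ g τ := by
  ext τ
  have h1 : ((ModularGroup.T • τ : ℍ) : ℂ) = τ + 1 := by
    rw [UpperHalfPlane.modular_T_smul]
    simp [add_comm]
  have h2 : denom (ModularGroup.T : GL (Fin 2) ℝ) τ = 1 := by
    simp [ModularGroup.denom_apply, ModularGroup.coe_T]
  rw [SL_slash_apply, h1, h2, h]
  simp

/-- A holomorphic function on the upper half-plane with the transformation rules of weight `k`
under `z ↦ -1 / z` and `z ↦ z + 1` and with a limit at the cusp, as a level one modular form. -/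
def modularFormOfLimit (g : ℂ → ℂ) (k : ℤ) {c : ℂ}
    (hS : ∀ z : ℂ, 0 < z.im → g (-1 / z) = z ^ k * g z) (hT : ∀ z : ℂ, g (z + 1) = g z)
    (hd : ∀ z : ℂ, 0 < z.im → DifferentiableAt ℂ g z)
    (hl : Tendsto (fun τ : ℍ ↦ g τ) atImInfty (𝓝 c)) : ModularForm 𝒮ℒ k where
  toFun τ := g τ
  slash_action_eq' A hA := by
    obtain ⟨A, rfl⟩ := hA
    exact SlashInvariantForm.slash_action_generators_SL2Z (slash_S_eq hS) (slash_T_eq hT) A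
  holo' := by
    rw [UpperHalfPlane.mdifferentiable_iff]
    refine .congr (fun z hz ↦ (hd z hz).differentiableWithinAt) fun z hz ↦ ?_
    simp [ofComplex_apply_of_im_pos hz]
  bdd_at_cusps' hc := by
    rw [Subgroup.IsArithmetic.isCusp_iff_isCusp_SL2Z] at hc
    rw [OnePoint.isBoundedAt_iff_forall_SL2Z hc]
    intro γ _
    rw [SlashInvariantForm.slash_action_generators_SL2Z (slash_S_eq hS) (slash_T_eq hT)]
    exact hl.isBigO_one ℝ

lemma tendsto_E_atImInfty {k : ℕ} (hk : 3 ≤ k) (hk2 : Even k) :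
    Tendsto (E hk) atImInfty (𝓝 1) := by
  have hv : valueAtInfty (E hk) = 1 := by
    rw [← UpperHalfPlane.qExpansion_coeff_zero one_pos
      (ModularFormClass.analyticAt_cuspFunction_zero (E hk) one_pos one_mem_strictPeriods_SL)
      (SlashInvariantFormClass.periodic_comp_ofComplex (E hk) one_mem_strictPeriods_SL)]
    exact E_qExpansion_coeff_zero hk hk2
  obtain ⟨c, hc, h⟩ := ModularFormClass.exp_decay_sub_atImInfty' (E hk)
  have h0 : Tendsto (fun τ : ℍ ↦ Real.exp (-c * τ.im)) atImInfty (𝓝 0) :=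
    Real.tendsto_exp_atBot.comp
      (tendsto_comap.const_mul_atTop_of_neg (neg_lt_zero.mpr hc))
  simpa [hv] using (h.trans_tendsto h0).add_const (1 : ℂ)

lemma eq_E_of_tendsto_one {k : ℕ} {j : ℤ} (hk : 3 ≤ k) (hk2 : Even k) (hj : j = k)
    (hrank : Module.rank ℂ (ModularForm 𝒮ℒ j) = 1) (f : ModularForm 𝒮ℒ j)
    (hf : Tendsto f atImInfty (𝓝 1)) (τ : ℍ) : f τ = E hk τ := by
  subst hj
  obtain ⟨c, hc⟩ := (finrank_eq_one_iff_of_nonzero' (E hk) (E_ne_zero hk hk2)).mp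
    (Module.rank_eq_one_iff_finrank_eq_one.mp hrank) f
  have h1 : Tendsto f atImInfty (𝓝 (c * 1)) := by
    rw [← hc]
    exact (tendsto_E_atImInfty hk hk2).const_mul c
  have h2 := tendsto_nhds_unique h1 hf
  rw [mul_one] at h2
  rw [← hc, h2, one_smul]

lemma E_eq_Eis {k : ℕ} (hk : 3 ≤ k) (τ : ℍ) : E hk τ = Eis k τ := by
  have h : E hk τ = (1 / 2 : ℂ) * eisensteinSeries (0 : Fin 2 → ZMod 1) k τ := rfl
  rw [h, Eis, eisensteinSeries]
  congr 1
  rw [← ((finTwoArrowEquiv ℤ).subtypeEquiv fun v ↦ gammaSet_one_mem_iff (r := 1) v).tsum_eq]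
  refine tsum_congr fun v ↦ ?_
  simp [eisSummand, finTwoArrowEquiv]

end LevelOne

section Comparison

open Filter ModularForm EisensteinSeries MatrixGroups

open UpperHalfPlane hiding I

lemma normF_eq_one {z : ℂ} (hz : 0 < z.im) : normF z = 1 := by
  obtain ⟨c, hc⟩ := ModularFormClass.levelOne_weight_zero_const (modularFormOfLimit normF 0
    (fun w hw ↦ by rw [normF_neg_inv hw, zpow_zero, one_mul]) normF_add_one
    (fun w hw ↦ differentiableAt_normF hw) tendsto_normF_atImInfty)
  have h (τ : ℍ) : normF τ = c := congrFun hc τ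
  have h1 := tendsto_normF_atImInfty
  simp only [h] at h1
  rw [← tendsto_nhds_unique tendsto_const_nhds h1]
  exact h ⟨z, hz⟩

lemma normH_eq_Eis {z : ℂ} (hz : 0 < z.im) : normH z = Eis 4 z := by
  have h := eq_E_of_tendsto_one (k := 4) (by norm_num) (by decide) rfl
    levelOne_weight_four_rank_one
    (modularFormOfLimit normH 4 (fun w hw ↦ by exact_mod_cast normH_neg_inv hw) normH_add_one
      (fun w hw ↦ differentiableAt_normH hw) tendsto_normH_atImInfty) tendsto_normH_atImInfty
  exact (h ⟨z, hz⟩).trans (E_eq_Eis _ ⟨z, hz⟩)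

lemma normT_eq_Eis {z : ℂ} (hz : 0 < z.im) : normT z = Eis 6 z := by
  have h := eq_E_of_tendsto_one (k := 6) (by norm_num) (by decide) rfl
    levelOne_weight_six_rank_one
    (modularFormOfLimit normT 6 (fun w hw ↦ by exact_mod_cast normT_neg_inv hw) normT_add_one
      (fun w hw ↦ differentiableAt_normT hw) tendsto_normT_atImInfty) tendsto_normT_atImInfty
  exact (h ⟨z, hz⟩).trans (E_eq_Eis _ ⟨z, hz⟩)

end Comparison

theorem stmt19 (z : ℂ) (hz : 0 < z.im) :
    kleinF (x1 z) (x2 z) = -Δfun z ∧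
    kleinH (x1 z) (x2 z) = -((etaF z) ^ 8 * Δfun z * Eis 4 z) ∧
    kleinT (x1 z) (x2 z) = (Δfun z) ^ 2 * Eis 6 z ∧
    (kleinT (x1 z) (x2 z)) ^ 2 + (kleinH (x1 z) (x2 z)) ^ 3 = 1728 * (kleinF (x1 z) (x2 z)) ^ 5 := by
  have he := etaF_ne_zero hz
  refine ⟨?_, ?_, ?_, klein_relation _ _⟩
  · have h := normF_eq_one hz
    rw [normF, div_eq_iff (pow_ne_zero _ he)] at h
    rw [x1, x2, kleinF_mul_mul, Δfun]
    linear_combination -etaF z ^ 12 * h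
  · have h := normH_eq_Eis hz
    rw [normH, div_eq_iff (pow_ne_zero _ he)] at h
    rw [x1, x2, kleinH_mul_mul, Δfun]
    linear_combination -etaF z ^ 20 * h
  · have h := normT_eq_Eis hz
    rw [normT, div_eq_iff (pow_ne_zero _ he)] at h
    rw [x1, x2, kleinT_mul_mul, Δfun]
    linear_combination etaF z ^ 30 * h
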